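/- Let t ≥ 2 be an integer, let (X, A_X) and (Y, A_Y) be finite networks, and let φ : X → Y be a dissimilarity reducing map, i.e., A_X(x,x') ≥ A_Y(φ(x), φ(x')) for all x, x' ∈ X. Then for all x, x' ∈ X, u^{SR(t)}_X(x,x') ≥ u^{SR(t)}_Y(φ(x),φ(x')), i.e., the semi-reciprocal method H^{SR(t)} satisfies the Axiom of Transformation. -/

import Mathlib

noncomputable section

/-- Cost of a chain (a finite ordered list of nodes): the maximum dissimilarity
encountered over consecutive pairs (0 for chains with fewer than two nodes). -/
def chainCost {X : Type*} (A : X → X → ℝ) : List X → ℝ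
  | [] => 0
  | [_] => 0
  | a :: b :: rest => max (A a b) (chainCost A (b :: rest))

/-- The set of costs of chains from `x` to `x'`. -/
def chainCosts {X : Type*} (A : X → X → ℝ) (x x' : X) : Set ℝ :=
  { c | ∃ l : List X, l.head? = some x ∧ l.getLast? = some x' ∧ chainCost A l = c }

/-- Directed minimum chain cost ũ*(x,x'). -/
def minChainCost {X : Type*} (A : X → X → ℝ) (x x' : X) : ℝ :=
  sInf (chainCosts A x x')

/-- The reciprocal ultrametric u^R. -/
def uR {X : Type*} (A : X → X → ℝ) (x x' : X) : ℝ :=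
  minChainCost (fun a b => max (A a b) (A b a)) x x'

/-- The nonreciprocal ultrametric u^NR. -/
def uNR {X : Type*} (A : X → X → ℝ) (x x' : X) : ℝ :=
  max (minChainCost A x x') (minChainCost A x' x)

/-- The set of costs of chains from `x` to `x'` having at most `t` nodes. -/
def boundedChainCosts {X : Type*} (A : X → X → ℝ) (t : ℕ) (x x' : X) : Set ℝ :=
  { c | ∃ l : List X, l.head? = some x ∧ l.getLast? = some x' ∧ l.length ≤ t ∧
      chainCost A l = c }

/-- A^{SR(t)}(x,x'): minimum cost over chains from `x` to `x'` with at most `t` nodes. -/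
def ASR {X : Type*} (A : X → X → ℝ) (t : ℕ) (x x' : X) : ℝ :=
  sInf (boundedChainCosts A t x x')

/-- The semi-reciprocal ultrametric u^{SR(t)}. -/
def uSR {X : Type*} (A : X → X → ℝ) (t : ℕ) (x x' : X) : ℝ :=
  minChainCost (fun a b => max (ASR A t a b) (ASR A t b a)) x x'

theorem chainCost_nonneg {X : Type*} (A : X → X → ℝ) : ∀ l : List X, 0 ≤ chainCost A l
  | [] => le_rfl
  | [_] => le_rfl
  | _ :: b :: rest => (chainCost_nonneg A (b :: rest)).trans (le_max_right _ _)

theorem chainCost_map_le {X Y : Type*} {A : X → X → ℝ} {B : Y → Y → ℝ} {φ : X → Y}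
    (h : ∀ a b, B (φ a) (φ b) ≤ A a b) : ∀ l : List X, chainCost B (l.map φ) ≤ chainCost A l
  | [] => le_rfl
  | [_] => le_rfl
  | a :: b :: rest => max_le_max (h a b) (chainCost_map_le h (b :: rest))

theorem minChainCost_map_le {X Y : Type*} {A : X → X → ℝ} {B : Y → Y → ℝ} {φ : X → Y}
    (h : ∀ a b, B (φ a) (φ b) ≤ A a b) (x x' : X) :
    minChainCost B (φ x) (φ x') ≤ minChainCost A x x' := by
  refine le_csInf ⟨_, [x, x'], rfl, rfl, rfl⟩ ?_
  rintro _ ⟨l, hx, hx', rfl⟩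
  refine csInf_le_of_le ⟨0, ?_⟩ ⟨l.map φ, by simp [hx], by simp [hx'], rfl⟩
    (chainCost_map_le h l)
  rintro _ ⟨m, -, -, rfl⟩
  exact chainCost_nonneg B m

theorem ASR_map_le {X Y : Type*} {A : X → X → ℝ} {B : Y → Y → ℝ} {φ : X → Y} {t : ℕ}
    (ht : 2 ≤ t) (h : ∀ a b, B (φ a) (φ b) ≤ A a b) (x x' : X) :
    ASR B t (φ x) (φ x') ≤ ASR A t x x' := by
  refine le_csInf ⟨_, [x, x'], rfl, rfl, ht, rfl⟩ ?_
  rintro _ ⟨l, hx, hx', hl, rfl⟩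
  refine csInf_le_of_le ⟨0, ?_⟩ ⟨l.map φ, by simp [hx], by simp [hx'], by simpa using hl, rfl⟩
    (chainCost_map_le h l)
  rintro _ ⟨m, -, -, -, rfl⟩
  exact chainCost_nonneg B m

/-- the semi-reciprocal method H^{SR(t)} satisfies the Axiom of
Transformation: dissimilarity reducing maps do not increase semi-reciprocal
ultrametrics. -/
theorem semireciprocal_axiom_of_transformation {X Y : Type*} [Fintype X] [Fintype Y]
    (AX : X → X → ℝ) (AY : Y → Y → ℝ)
    (hnonnegX : ∀ x x' : X, 0 ≤ AX x x')
    (hidX : ∀ x x' : X, AX x x' = 0 ↔ x = x')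
    (hnonnegY : ∀ y y' : Y, 0 ≤ AY y y')
    (hidY : ∀ y y' : Y, AY y y' = 0 ↔ y = y')
    (t : ℕ) (ht : 2 ≤ t)
    (φ : X → Y) (hφ : ∀ x x' : X, AY (φ x) (φ x') ≤ AX x x') :
    ∀ x x' : X, uSR AY t (φ x) (φ x') ≤ uSR AX t x x' :=
  minChainCost_map_le fun a b => max_le_max (ASR_map_le ht hφ a b) (ASR_map_le ht hφ b a)
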